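/- arXiv:1603.04933 — 3 statements merged into one kernel-verified Lean document; each statement's English description precedes it below -/
import Mathlib

section
/- Let C be a 2-copula, let m₁, m₂ ≥ 1, and let 0 = q_{1,0} < q_{1,1} < ⋯ < q_{1,m₁} = 1 and 0 = q_{2,0} < q_{2,1} < ⋯ < q_{2,m₂} = 1 be meshes of [0,1]. Define C_Q : [0,1] × [0,1] → ℝ as the piecewise-bilinear interpolant of C on this mesh: for (u,v) with q_{1,i−1} ≤ u ≤ q_{1,i} and q_{2,j−1} ≤ v ≤ q_{2,j}, setting λ_{1i}(u) = (u − q_{1,i−1})/(q_{1,i} − q_{1,i−1}) and λ_{2j}(v) = (v − q_{2,j−1})/(q_{2,j} − q_{2,j−1}), let C_Q(u,v) = (1−λ_{1i}(u))(1−λ_{2j}(v)) C(q_{1,i−1}, q_{2,j−1}) + (1−λ_{1i}(u)) λ_{2j}(v) C(q_{1,i−1}, q_{2,j}) + λ_{1i}(u)(1−λ_{2j}(v)) C(q_{1,i}, q_{2,j−1}) + λ_{1i}(u) λ_{2j}(v) C(q_{1,i}, q_{2,j}). Then C_Q is well defined (the formulas for adjacent cells agree on shared edges), C_Q is a 2-copula,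 and C_Q(q_{1,i}, q_{2,j}) = C(q_{1,i}, q_{2,j}) for all grid points. -/
open Set

/-- A 2-copula on `[0,1]²`. -/
def IsCopula (C : ℝ → ℝ → ℝ) : Prop :=
  (∀ u ∈ Icc (0:ℝ) 1, C u 0 = 0) ∧ (∀ v ∈ Icc (0:ℝ) 1, C 0 v = 0) ∧
  (∀ u ∈ Icc (0:ℝ) 1, C u 1 = u) ∧ (∀ v ∈ Icc (0:ℝ) 1, C 1 v = v) ∧
  (∀ u₁ u₂ v₁ v₂ : ℝ, u₁ ∈ Icc (0:ℝ) 1 → u₂ ∈ Icc (0:ℝ) 1 → v₁ ∈ Icc (0:ℝ) 1 →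
    v₂ ∈ Icc (0:ℝ) 1 → u₁ ≤ u₂ → v₁ ≤ v₂ →
    0 ≤ C u₂ v₂ - C u₂ v₁ - C u₁ v₂ + C u₁ v₁)


/-- Clamped ramp on the `i`-th cell. -/
noncomputable def ramp (q : ℕ → ℝ) (i : ℕ) (u : ℝ) : ℝ :=
  max 0 (min 1 ((u - q i) / (q (i + 1) - q i)))

theorem ramp_mono (q : ℕ → ℝ) (i : ℕ) (h : q i < q (i + 1)) {u v : ℝ} (huv : u ≤ v) :
    ramp q i u ≤ ramp q i v := by
  have : 0 < q (i + 1) - q i := by linarith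
  unfold ramp
  gcongr

theorem ramp_one (q : ℕ → ℝ) (i : ℕ) (h : q i < q (i + 1)) {u : ℝ} (hu : q (i + 1) ≤ u) :
    ramp q i u = 1 := by
  have h0 : 0 < q (i + 1) - q i := by linarith
  have : 1 ≤ (u - q i) / (q (i + 1) - q i) := by rw [le_div_iff₀ h0]; linarith
  unfold ramp
  rw [min_eq_left this]; norm_num

theorem ramp_zero (q : ℕ → ℝ) (i : ℕ) (h : q i < q (i + 1)) {u : ℝ} (hu : u ≤ q i) :
    ramp q i u = 0 := by
  have h0 : 0 < q (i + 1) - q i := by linarith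
  have : (u - q i) / (q (i + 1) - q i) ≤ 0 := div_nonpos_of_nonpos_of_nonneg (by linarith) h0.le
  unfold ramp
  exact max_eq_left ((min_le_right _ _).trans this)

theorem ramp_mid (q : ℕ → ℝ) (i : ℕ) (h : q i < q (i + 1)) {u : ℝ} (hu : q i ≤ u)
    (hu' : u ≤ q (i + 1)) : ramp q i u = (u - q i) / (q (i + 1) - q i) := by
  have h0 : 0 < q (i + 1) - q i := by linarith
  have h1 : (u - q i) / (q (i + 1) - q i) ≤ 1 := by rw [div_le_one h0]; linarith
  have h2 : 0 ≤ (u - q i) / (q (i + 1) - q i) := div_nonneg (by linarith) h0.le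
  unfold ramp
  rw [min_eq_right h1, max_eq_right h2]

theorem mesh_le (q : ℕ → ℝ) (m : ℕ) (hq : ∀ i < m, q i < q (i + 1)) (a b : ℕ) (hab : a ≤ b)
    (hb : b ≤ m) : q a ≤ q b := by
  induction b, hab using Nat.le_induction with
  | base => exact le_rfl
  | succ n hn ih => exact (ih (by omega)).trans (hq n (by omega)).le

theorem mesh_cell (q : ℕ → ℝ) (m : ℕ) (hm : 1 ≤ m) (u : ℝ) (h0 : q 0 ≤ u) (h1 : u ≤ q m) :
    ∃ k < m, q k ≤ u ∧ u ≤ q (k + 1) := by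
  induction m, hm using Nat.le_induction with
  | base => exact ⟨0, by omega, h0, h1⟩
  | succ n hn ih =>
    rcases le_total u (q n) with h | h
    · obtain ⟨k, hk, hh⟩ := ih h
      exact ⟨k, by omega, hh⟩
    · exact ⟨n, by omega, h, h1⟩

/-- Telescoping evaluation of the ramp sum on a cell. -/
theorem ramp_sum (q : ℕ → ℝ) (m : ℕ) (hq : ∀ i < m, q i < q (i + 1)) (f : ℕ → ℝ) (k : ℕ)
    (hk : k < m) (u : ℝ) (h0 : q k ≤ u) (h1 : u ≤ q (k + 1)) :
    ∑ i ∈ Finset.range m, ramp q i u * (f (i + 1) - f i) =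
      (1 - (u - q k) / (q (k + 1) - q k)) * f k
        + (u - q k) / (q (k + 1) - q k) * f (k + 1) - f 0 := by
  have key : ∀ n ≤ m, ∑ i ∈ Finset.range n, ramp q i u * (f (i + 1) - f i) =
      if n ≤ k then f n - f 0 else (1 - (u - q k) / (q (k + 1) - q k)) * f k
        + (u - q k) / (q (k + 1) - q k) * f (k + 1) - f 0 := by
    intro n
    induction n with
    | zero => simp
    | succ n ih =>
      intro hn
      rw [Finset.sum_range_succ, ih (by omega)]
      rcases lt_trichotomy n k with h | h | h
      · rw [if_pos h.le, if_pos (by omega), ramp_one q n (hq n (by omega))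
          ((mesh_le q m hq (n + 1) k (by omega) hk.le).trans h0)]
        ring
      · subst h
        rw [if_pos le_rfl, if_neg (by omega), ramp_mid q n (hq n hk) h0 h1]
        ring
      · rw [if_neg (by omega), if_neg (by omega), ramp_zero q n (hq n (by omega))
          (h1.trans (mesh_le q m hq (k + 1) n (by omega) (by omega)))]
        ring
  rw [key m le_rfl, if_neg (by omega)]

theorem ramp_sum_node (q : ℕ → ℝ) (m : ℕ) (hm : 1 ≤ m) (hq : ∀ i < m, q i < q (i + 1))
    (f : ℕ → ℝ) (k : ℕ) (hk : k ≤ m) :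
    ∑ i ∈ Finset.range m, ramp q i (q k) * (f (i + 1) - f i) = f k - f 0 := by
  rcases Nat.eq_zero_or_pos k with h | h
  · subst h
    rw [ramp_sum q m hq f 0 (by omega) (q 0) le_rfl (hq 0 (by omega)).le]
    simp
  · obtain ⟨k, rfl⟩ : ∃ l, k = l + 1 := ⟨k - 1, by omega⟩
    have := hq k (by omega)
    rw [ramp_sum q m hq f k (by omega) (q (k + 1)) this.le le_rfl,
      div_self (sub_pos.2 this).ne']
    ring

theorem ramp_sum_self (q : ℕ → ℝ) (m : ℕ) (hm : 1 ≤ m) (hq : ∀ i < m, q i < q (i + 1))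
    (u : ℝ) (h0 : q 0 ≤ u) (h1 : u ≤ q m) :
    ∑ i ∈ Finset.range m, ramp q i u * (q (i + 1) - q i) = u - q 0 := by
  obtain ⟨k, hk, h2, h3⟩ := mesh_cell q m hm u h0 h1
  rw [ramp_sum q m hq q k hk u h2 h3]
  have := hq k hk
  have h4 : q (k + 1) - q k ≠ 0 := (sub_pos.2 this).ne'
  field_simp
  ring

/-- The piecewise-bilinear interpolant of a copula on a mesh is well defined
(there is a single function satisfying the bilinear formula on every closed cell),
is a 2-copula, and agrees with the copula at the grid points. -/
theorem bilinear_interpolant_isCopula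
    (C : ℝ → ℝ → ℝ) (hC : IsCopula C)
    (m₁ m₂ : ℕ) (hm₁ : 1 ≤ m₁) (hm₂ : 1 ≤ m₂)
    (q₁ q₂ : ℕ → ℝ)
    (hq₁0 : q₁ 0 = 0) (hq₁m : q₁ m₁ = 1) (hq₁mono : ∀ i < m₁, q₁ i < q₁ (i + 1))
    (hq₂0 : q₂ 0 = 0) (hq₂m : q₂ m₂ = 1) (hq₂mono : ∀ j < m₂, q₂ j < q₂ (j + 1)) :
    ∃ CQ : ℝ → ℝ → ℝ,
      (∀ i j : ℕ, 1 ≤ i → i ≤ m₁ → 1 ≤ j → j ≤ m₂ → ∀ u v : ℝ,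
        q₁ (i - 1) ≤ u → u ≤ q₁ i → q₂ (j - 1) ≤ v → v ≤ q₂ j →
        CQ u v =
          (1 - (u - q₁ (i - 1)) / (q₁ i - q₁ (i - 1))) *
              (1 - (v - q₂ (j - 1)) / (q₂ j - q₂ (j - 1))) * C (q₁ (i - 1)) (q₂ (j - 1))
          + (1 - (u - q₁ (i - 1)) / (q₁ i - q₁ (i - 1))) *
              ((v - q₂ (j - 1)) / (q₂ j - q₂ (j - 1))) * C (q₁ (i - 1)) (q₂ j)
          + ((u - q₁ (i - 1)) / (q₁ i - q₁ (i - 1))) *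
              (1 - (v - q₂ (j - 1)) / (q₂ j - q₂ (j - 1))) * C (q₁ i) (q₂ (j - 1))
          + ((u - q₁ (i - 1)) / (q₁ i - q₁ (i - 1))) *
              ((v - q₂ (j - 1)) / (q₂ j - q₂ (j - 1))) * C (q₁ i) (q₂ j)) ∧
      IsCopula CQ ∧
      (∀ i j : ℕ, i ≤ m₁ → j ≤ m₂ → CQ (q₁ i) (q₂ j) = C (q₁ i) (q₂ j)) := by
  obtain ⟨hC1, hC2, hC3, hC4, hC5⟩ := hC
  have mem₁ : ∀ i ≤ m₁, q₁ i ∈ Icc (0:ℝ) 1 := fun i hi =>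
    ⟨hq₁0 ▸ mesh_le q₁ m₁ hq₁mono 0 i (by omega) hi, hq₁m ▸ mesh_le q₁ m₁ hq₁mono i m₁ hi le_rfl⟩
  have mem₂ : ∀ i ≤ m₂, q₂ i ∈ Icc (0:ℝ) 1 := fun i hi =>
    ⟨hq₂0 ▸ mesh_le q₂ m₂ hq₂mono 0 i (by omega) hi, hq₂m ▸ mesh_le q₂ m₂ hq₂mono i m₂ hi le_rfl⟩
  let D : ℕ → ℕ → ℝ := fun i j => C (q₁ (i + 1)) (q₂ (j + 1)) - C (q₁ (i + 1)) (q₂ j)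
    - C (q₁ i) (q₂ (j + 1)) + C (q₁ i) (q₂ j)
  let CQ : ℝ → ℝ → ℝ := fun u v => ∑ i ∈ Finset.range m₁, ∑ j ∈ Finset.range m₂,
    ramp q₁ i u * ramp q₂ j v * D i j
  -- for fixed `v`, the interpolant is a ramp sum of the partial interpolants
  have expand : ∀ u v, CQ u v = ∑ i ∈ Finset.range m₁, ramp q₁ i u *
      ((∑ j ∈ Finset.range m₂, ramp q₂ j v * (C (q₁ (i + 1)) (q₂ (j + 1)) - C (q₁ (i + 1)) (q₂ j)))
      - ∑ j ∈ Finset.range m₂, ramp q₂ j v * (C (q₁ i) (q₂ (j + 1)) - C (q₁ i) (q₂ j))) := by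
    intro u v
    refine Finset.sum_congr rfl fun i _ => ?_
    rw [← Finset.sum_sub_distrib, Finset.mul_sum]
    refine Finset.sum_congr rfl fun j _ => ?_
    simp only [D]
    ring
  have cell : ∀ i < m₁, ∀ v, ∀ u, q₁ i ≤ u → u ≤ q₁ (i + 1) → CQ u v =
      (1 - (u - q₁ i) / (q₁ (i + 1) - q₁ i)) *
        (∑ j ∈ Finset.range m₂, ramp q₂ j v * (C (q₁ i) (q₂ (j + 1)) - C (q₁ i) (q₂ j)))
      + (u - q₁ i) / (q₁ (i + 1) - q₁ i) *
        (∑ j ∈ Finset.range m₂, ramp q₂ j v *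
          (C (q₁ (i + 1)) (q₂ (j + 1)) - C (q₁ (i + 1)) (q₂ j))) := by
    intro i hi v u h0 h1
    rw [expand, ramp_sum q₁ m₁ hq₁mono (fun i => ∑ j ∈ Finset.range m₂, ramp q₂ j v *
      (C (q₁ i) (q₂ (j + 1)) - C (q₁ i) (q₂ j))) i hi u h0 h1]
    have hz : ∑ j ∈ Finset.range m₂, ramp q₂ j v *
        (C (q₁ 0) (q₂ (j + 1)) - C (q₁ 0) (q₂ j)) = 0 := by
      refine Finset.sum_eq_zero fun j hj => ?_
      have hj := Finset.mem_range.1 hj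
      rw [hq₁0, hC2 _ (mem₂ _ (by omega)), hC2 _ (mem₂ _ (by omega))]
      ring
    simp only [hz, sub_zero]
  have formula : ∀ i < m₁, ∀ j < m₂, ∀ u v, q₁ i ≤ u → u ≤ q₁ (i + 1) → q₂ j ≤ v →
      v ≤ q₂ (j + 1) → CQ u v =
      (1 - (u - q₁ i) / (q₁ (i + 1) - q₁ i)) *
        ((1 - (v - q₂ j) / (q₂ (j + 1) - q₂ j)) * C (q₁ i) (q₂ j)
          + (v - q₂ j) / (q₂ (j + 1) - q₂ j) * C (q₁ i) (q₂ (j + 1)))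
      + (u - q₁ i) / (q₁ (i + 1) - q₁ i) *
        ((1 - (v - q₂ j) / (q₂ (j + 1) - q₂ j)) * C (q₁ (i + 1)) (q₂ j)
          + (v - q₂ j) / (q₂ (j + 1) - q₂ j) * C (q₁ (i + 1)) (q₂ (j + 1))) := by
    intro i hi j hj u v h0 h1 h2 h3
    rw [cell i hi v u h0 h1, ramp_sum q₂ m₂ hq₂mono (fun j => C (q₁ i) (q₂ j)) j hj v h2 h3,
      ramp_sum q₂ m₂ hq₂mono (fun j => C (q₁ (i + 1)) (q₂ j)) j hj v h2 h3]
    simp only [hq₂0]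
    rw [hC1 _ (mem₁ _ (by omega)), hC1 _ (mem₁ _ (by omega))]
    ring
  -- values when the second coordinate is a node
  have node₂ : ∀ u, ∀ j ≤ m₂, CQ u (q₂ j) =
      ∑ i ∈ Finset.range m₁, ramp q₁ i u * (C (q₁ (i + 1)) (q₂ j) - C (q₁ i) (q₂ j)) := by
    intro u j hj
    rw [expand]
    refine Finset.sum_congr rfl fun i hi => ?_
    have hi := Finset.mem_range.1 hi
    rw [ramp_sum_node q₂ m₂ hm₂ hq₂mono (fun j => C (q₁ i) (q₂ j)) j hj,
      ramp_sum_node q₂ m₂ hm₂ hq₂mono (fun j => C (q₁ (i + 1)) (q₂ j)) j hj, hq₂0,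
      hC1 _ (mem₁ _ (by omega)), hC1 _ (mem₁ _ (by omega))]
    ring
  -- values when the first coordinate is a node
  have node₁ : ∀ v, ∀ i ≤ m₁, CQ (q₁ i) v =
      ∑ j ∈ Finset.range m₂, ramp q₂ j v * (C (q₁ i) (q₂ (j + 1)) - C (q₁ i) (q₂ j)) := by
    intro v i hi
    rw [expand, ramp_sum_node q₁ m₁ hm₁ hq₁mono (fun i => ∑ j ∈ Finset.range m₂, ramp q₂ j v *
      (C (q₁ i) (q₂ (j + 1)) - C (q₁ i) (q₂ j))) i hi, sub_eq_self]
    refine Finset.sum_eq_zero fun j hj => ?_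
    have hj := Finset.mem_range.1 hj
    rw [hq₁0, hC2 _ (mem₂ _ (by omega)), hC2 _ (mem₂ _ (by omega))]
    ring
  refine ⟨CQ, ?_, ⟨?_, ?_, ?_, ?_, ?_⟩, ?_⟩
  · intro i j hi hi' hj hj' u v h0 h1 h2 h3
    obtain ⟨i, rfl⟩ : ∃ l, i = l + 1 := ⟨i - 1, by omega⟩
    obtain ⟨j, rfl⟩ : ∃ l, j = l + 1 := ⟨j - 1, by omega⟩
    simp only [Nat.add_sub_cancel] at *
    rw [formula i (by omega) j (by omega) u v h0 h1 h2 h3]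
    ring
  · intro u _
    have h := node₂ u 0 (by omega)
    rw [hq₂0] at h
    rw [h]
    refine Finset.sum_eq_zero fun i hi => ?_
    have hi := Finset.mem_range.1 hi
    rw [hC1 _ (mem₁ _ (by omega)), hC1 _ (mem₁ _ (by omega))]
    ring
  · intro v _
    have h := node₁ v 0 (by omega)
    rw [hq₁0] at h
    rw [h]
    refine Finset.sum_eq_zero fun j hj => ?_
    have hj := Finset.mem_range.1 hj
    rw [hC2 _ (mem₂ _ (by omega)), hC2 _ (mem₂ _ (by omega))]
    ring
  · intro u hu
    have h := node₂ u m₂ le_rfl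
    rw [hq₂m] at h
    have h' := ramp_sum_self q₁ m₁ hm₁ hq₁mono u (hq₁0 ▸ hu.1) (hq₁m ▸ hu.2)
    rw [hq₁0, sub_zero] at h'
    rw [h]
    refine Eq.trans (Finset.sum_congr rfl fun i hi => ?_) h'
    have hi := Finset.mem_range.1 hi
    rw [hC3 _ (mem₁ _ (by omega)), hC3 _ (mem₁ _ (by omega))]
  · intro v hv
    have h := node₁ v m₁ le_rfl
    rw [hq₁m] at h
    have h' := ramp_sum_self q₂ m₂ hm₂ hq₂mono v (hq₂0 ▸ hv.1) (hq₂m ▸ hv.2)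
    rw [hq₂0, sub_zero] at h'
    rw [h]
    refine Eq.trans (Finset.sum_congr rfl fun i hi => ?_) h'
    have hi := Finset.mem_range.1 hi
    rw [hC4 _ (mem₂ _ (by omega)), hC4 _ (mem₂ _ (by omega))]
  · intro u₁ u₂ v₁ v₂ _ _ _ _ hu hv
    have e : CQ u₂ v₂ - CQ u₂ v₁ - CQ u₁ v₂ + CQ u₁ v₁ =
        ∑ i ∈ Finset.range m₁, ∑ j ∈ Finset.range m₂,
          (ramp q₁ i u₂ - ramp q₁ i u₁) * (ramp q₂ j v₂ - ramp q₂ j v₁) * D i j := by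
      simp only [CQ, ← Finset.sum_sub_distrib, ← Finset.sum_add_distrib]
      refine Finset.sum_congr rfl fun i _ => Finset.sum_congr rfl fun j _ => ?_
      ring
    rw [e]
    refine Finset.sum_nonneg fun i hi => Finset.sum_nonneg fun j hj => ?_
    have hi := Finset.mem_range.1 hi
    have hj := Finset.mem_range.1 hj
    refine mul_nonneg (mul_nonneg (sub_nonneg.2 (ramp_mono q₁ i (hq₁mono i hi) hu))
      (sub_nonneg.2 (ramp_mono q₂ j (hq₂mono j hj) hv))) ?_
    exact hC5 _ _ _ _ (mem₁ _ (by omega)) (mem₁ _ (by omega)) (mem₂ _ (by omega))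
      (mem₂ _ (by omega)) (hq₁mono i hi).le (hq₂mono j hj).le
  · intro i j hi hj
    rw [node₂ _ j hj, ramp_sum_node q₁ m₁ hm₁ hq₁mono (fun i => C (q₁ i) (q₂ j)) i hi, hq₁0,
      hC2 _ (mem₂ _ hj), sub_zero]
end

section
/- Let C be a 2-copula, m ≥ 1, and let C_LB(u,v) = ∑_{i=0}^{m} ∑_{j=0}^{m} C(i/m, j/m) N_i(u) N_j(v) be the linear B-spline approximation of C. Then for all (u,v) ∈ [0,1] × [0,1], |C_LB(u,v) − C(u,v)| ≤ 2/m. In particular, C_LB converges uniformly to C as m → ∞. -/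
open Set

/-- The linear B-spline basis functions on `[0,1]` with knots `i/m`. -/
noncomputable def N (m i : ℕ) (u : ℝ) : ℝ :=
  if i = 0 then
    (if 0 ≤ u ∧ u < 1 / (m : ℝ) then 1 - m * u else 0)
  else if i = m then
    (if ((m : ℝ) - 1) / m ≤ u ∧ u ≤ 1 then m * u - ((m : ℝ) - 1) else 0)
  else if ((i : ℝ) - 1) / m ≤ u ∧ u < (i : ℝ) / m then m * u - ((i : ℝ) - 1)
  else if (i : ℝ) / m ≤ u ∧ u < ((i : ℝ) + 1) / m then ((i : ℝ) + 1) - m * u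
  else 0

lemma N_sum (m : ℕ) (hm : 1 ≤ m) (u : ℝ) (hu : u ∈ Icc (0:ℝ) 1) :
    ∃ k : ℕ, k < m ∧ (k : ℝ) ≤ m * u ∧ m * u ≤ k + 1 ∧
      ∀ f : ℕ → ℝ, ∑ i ∈ Finset.range (m + 1), f i * N m i u
        = f k * (k + 1 - m * u) + f (k + 1) * (m * u - k) := by
  obtain ⟨h0, h1⟩ := hu
  have hm0 : (0:ℝ) < m := by exact_mod_cast hm
  have key : ∃ k : ℕ, k < m ∧ (k : ℝ) ≤ m * u ∧ m * u ≤ k + 1 ∧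
      (m * u < k + 1 ∨ (k + 1 = m ∧ u = 1)) := by
    rcases h1.lt_or_eq with h | h
    · have hnn : 0 ≤ m * u := by positivity
      have hlt := Nat.lt_floor_add_one (m * u)
      refine ⟨⌊m * u⌋₊, ?_, Nat.floor_le hnn, hlt.le, Or.inl hlt⟩
      rw [Nat.floor_lt hnn]
      nlinarith
    · refine ⟨m - 1, by omega, ?_, ?_, Or.inr ⟨by omega, h⟩⟩ <;>
      · rw [Nat.cast_sub hm, h]; push_cast; linarith
  obtain ⟨k, hk, hk0, hk1, hk2⟩ := key
  refine ⟨k, hk, hk0, hk1, fun f => ?_⟩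
  have hmu : ∀ i : ℕ, N m i u =
    if i = 0 then (if m * u < 1 then 1 - m * u else 0)
    else if i = m then (if (m : ℝ) - 1 ≤ m * u then m * u - ((m : ℝ) - 1) else 0)
    else if ((i : ℝ) - 1) ≤ m * u ∧ m * u < (i : ℝ) then m * u - ((i : ℝ) - 1)
    else if (i : ℝ) ≤ m * u ∧ m * u < ((i : ℝ) + 1) then ((i : ℝ) + 1) - m * u
    else 0 := by
    intro i
    simp only [N, div_le_iff₀ hm0, lt_div_iff₀ hm0, h0, h1, and_true, true_and, mul_comm u]
  have hNk : N m k u = k + 1 - m * u := by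
    rw [hmu]
    rcases hk2 with h | ⟨h, h'⟩
    · have : k ≠ m := by omega
      have h3 : ¬ (m * u < (k:ℝ)) := by linarith
      by_cases hz : k = 0
      · subst hz
        simp at h ⊢
        intro; linarith
      · simp [hz, this, h3, hk0, h]
    · have hkm : (k:ℝ) + 1 = m := by exact_mod_cast h
      have : k ≠ m := by omega
      subst h'
      have h3 : ¬ ((m:ℝ) * 1 < (k:ℝ)) := by linarith
      have h4 : ¬ ((m:ℝ) * 1 < (k:ℝ) + 1) := by linarith
      have h5 : ¬ ((m:ℝ) * 1 < 1) := by
        have : (1:ℝ) ≤ m := by exact_mod_cast hm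
        linarith
      simp only [this, h3, h4, h5, and_false, if_false, ite_self]
      linarith
  have hNk1 : N m (k + 1) u = m * u - k := by
    rw [hmu]
    rw [if_neg (by omega)]
    by_cases hkm : k + 1 = m
    · have hkm' : (k:ℝ) + 1 = m := by exact_mod_cast hkm
      rw [if_pos hkm, if_pos (by linarith)]
      linarith
    · rw [if_neg hkm]
      have h : m * u < k + 1 := by
        rcases hk2 with h | h
        · exact h
        · exact absurd h.1 hkm
      push_cast
      rw [if_pos ⟨by linarith, h⟩]
      ring
  have hN0 : ∀ i ∈ Finset.range (m + 1), i ∉ ({k, k + 1} : Finset ℕ) → f i * N m i u = 0 := by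
    intro i hi hik
    simp only [Finset.mem_insert, Finset.mem_singleton, not_or] at hik
    simp only [Finset.mem_range] at hi
    have hz : N m i u = 0 := by
      rw [hmu]
      rcases Nat.lt_or_ge i k with hlt | hge
      · have h3 : (i:ℝ) + 1 ≤ k := by exact_mod_cast hlt
        have him : i ≠ m := by omega
        have h4 : ¬ (m * u < (i:ℝ)) := by linarith
        have h5 : ¬ (m * u < (i:ℝ) + 1) := by linarith
        have h6 : ¬ (m * u < 1) := by
          have : (0:ℝ) ≤ i := by positivity
          linarith
        simp [him, h4, h5, h6]
      · have hge' : k + 2 ≤ i := by omega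
        have h3 : (k:ℝ) + 2 ≤ i := by exact_mod_cast hge'
        have h : m * u < k + 1 := by
          rcases hk2 with h | h
          · exact h
          · omega
        rw [if_neg (by omega)]
        by_cases him : i = m
        · rw [if_pos him, if_neg]
          rw [← him]
          rw [← him] at h
          linarith
        · rw [if_neg him, if_neg (fun hh => by linarith [hh.1]),
            if_neg (fun hh => by linarith [hh.1])]
    rw [hz, mul_zero]
  rw [← Finset.sum_subset (s₁ := {k, k + 1}) _ hN0, Finset.sum_pair (by omega), hNk, hNk1]
  intro i hi
  simp only [Finset.mem_insert, Finset.mem_singleton] at hi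
  simp only [Finset.mem_range]
  omega

lemma copula_lip (C : ℝ → ℝ → ℝ) (hC : IsCopula C) (a u b v : ℝ)
    (ha : a ∈ Icc (0:ℝ) 1) (hu : u ∈ Icc (0:ℝ) 1)
    (hb : b ∈ Icc (0:ℝ) 1) (hv : v ∈ Icc (0:ℝ) 1) :
    |C a b - C u v| ≤ |a - u| + |b - v| := by
  obtain ⟨c1, c2, c3, c4, c5⟩ := hC
  have z : (0:ℝ) ∈ Icc (0:ℝ) 1 := by simp
  have o : (1:ℝ) ∈ Icc (0:ℝ) 1 := by simp
  have L : ∀ x ∈ Icc (0:ℝ) 1, ∀ y ∈ Icc (0:ℝ) 1, ∀ t ∈ Icc (0:ℝ) 1, x ≤ y →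
      |C y t - C x t| ≤ |y - x| := by
    intro x hx y hy t ht h
    have e1 := c5 x y 0 t hx hy z ht h ht.1
    have e2 := c5 x y t 1 hx hy ht o h ht.2
    rw [c1 x hx, c1 y hy] at e1
    rw [c3 x hx, c3 y hy] at e2
    rw [abs_of_nonneg (by linarith), abs_of_nonneg (by linarith)]
    linarith
  have R : ∀ x ∈ Icc (0:ℝ) 1, ∀ y ∈ Icc (0:ℝ) 1, ∀ t ∈ Icc (0:ℝ) 1, x ≤ y →
      |C t y - C t x| ≤ |y - x| := by
    intro x hx y hy t ht h
    have e1 := c5 0 t x y z ht hx hy ht.1 h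
    have e2 := c5 t 1 x y ht o hx hy ht.2 h
    rw [c2 x hx, c2 y hy] at e1
    rw [c4 x hx, c4 y hy] at e2
    rw [abs_of_nonneg (by linarith), abs_of_nonneg (by linarith)]
    linarith
  have l1 : |C a b - C u b| ≤ |a - u| := by
    rcases le_total u a with h | h
    · exact L u hu a ha b hb h
    · rw [abs_sub_comm, abs_sub_comm a]; exact L a ha u hu b hb h
  have r1 : |C u b - C u v| ≤ |b - v| := by
    rcases le_total v b with h | h
    · exact R v hv b hb u hu h
    · rw [abs_sub_comm, abs_sub_comm b]; exact R b hb v hv u hu h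
  linarith [abs_sub_le (C a b) (C u b) (C u v)]

lemma avg_bound (p q x y c e : ℝ) (hp : 0 ≤ p) (hq : 0 ≤ q) (hpq : p + q = 1)
    (hx : |x - c| ≤ e) (hy : |y - c| ≤ e) : |x * p + y * q - c| ≤ e := by
  obtain rfl : q = 1 - p := by linarith
  rw [abs_le] at *
  constructor <;> nlinarith [mul_le_mul_of_nonneg_right hx.1 hp, mul_le_mul_of_nonneg_right hx.2 hp,
    mul_le_mul_of_nonneg_right hy.1 hq, mul_le_mul_of_nonneg_right hy.2 hq]

/-- The linear B-spline approximation of a copula `C` approximates `C` uniformly with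
error at most `2/m`. -/
theorem bspline_uniform_bound (C : ℝ → ℝ → ℝ) (hC : IsCopula C)
    (m : ℕ) (hm : 1 ≤ m) :
    ∀ u ∈ Icc (0:ℝ) 1, ∀ v ∈ Icc (0:ℝ) 1,
      |(∑ i ∈ Finset.range (m + 1), ∑ j ∈ Finset.range (m + 1),
          C ((i : ℝ) / m) ((j : ℝ) / m) * N m i u * N m j v) - C u v| ≤ 2 / m := by
  intro u hu v hv
  have hm0 : (0:ℝ) < m := by exact_mod_cast hm
  obtain ⟨k, hk, hk0, hk1, hks⟩ := N_sum m hm u hu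
  obtain ⟨l, hl, hl0, hl1, hls⟩ := N_sum m hm v hv
  have e : ∑ i ∈ Finset.range (m + 1), ∑ j ∈ Finset.range (m + 1),
          C ((i : ℝ) / m) ((j : ℝ) / m) * N m i u * N m j v =
      ∑ i ∈ Finset.range (m + 1), (∑ j ∈ Finset.range (m + 1),
          C ((i : ℝ) / m) ((j : ℝ) / m) * N m j v) * N m i u := by
    refine Finset.sum_congr rfl fun i _ => ?_
    rw [Finset.sum_mul]
    exact Finset.sum_congr rfl fun j _ => by ring
  rw [e, hks]
  simp only [hls (fun j => C _ ((j : ℝ) / m))]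
  have near : ∀ (k : ℕ) (u : ℝ), (k:ℝ) ≤ m * u → m * u ≤ k + 1 → 
      |(k:ℝ) / m - u| ≤ 1 / m ∧ |((k + 1 : ℕ) : ℝ) / m - u| ≤ 1 / m := by
    intro k u h1 h2
    have a1 : (k:ℝ) / m - u = (k - m * u) / m := by field_simp
    have a2 : ((k + 1 : ℕ) : ℝ) / m - u = (k + 1 - m * u) / m := by push_cast; field_simp
    rw [a1, a2, abs_div, abs_div, abs_of_pos hm0]
    constructor <;> gcongr <;> rw [abs_le] <;> constructor <;> linarith
  have mem : ∀ i : ℕ, i ≤ m → (i:ℝ) / m ∈ Icc (0:ℝ) 1 := by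
    intro i hi
    refine ⟨by positivity, ?_⟩
    rw [div_le_one hm0]
    exact_mod_cast hi
  have fin : ∀ i j : ℕ, i ≤ m → j ≤ m → |(i:ℝ) / m - u| ≤ 1 / m → |(j:ℝ) / m - v| ≤ 1 / m →
      |C ((i:ℝ) / m) ((j:ℝ) / m) - C u v| ≤ 2 / m := by
    intro i j hi hj h1 h2
    have := copula_lip C hC _ u _ v (mem i hi) hu (mem j hj) hv
    have h3 : (2:ℝ) / m = 1 / m + 1 / m := by ring
    linarith
  obtain ⟨nk, nk'⟩ := near k u hk0 hk1
  obtain ⟨nl, nl'⟩ := near l v hl0 hl1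
  apply avg_bound _ _ _ _ _ _ (by linarith) (by linarith) (by ring) <;>
    apply avg_bound _ _ _ _ _ _ (by linarith) (by linarith) (by ring) <;>
    apply fin <;> first | assumption | omega
end

section
/- Let m ≥ 1 and let S : {0,…,m} × {0,…,m} → ℝ be a subcopula on the uniform mesh, i.e., S(i,0) = 0 = S(0,j), S(i,m) = i/m, S(m,j) = j/m for all i, j ∈ {0,…,m}, and S(i₂,j₂) − S(i₂,j₁) − S(i₁,j₂) + S(i₁,j₁) ≥ 0 for all 0 ≤ i₁ ≤ i₂ ≤ m and 0 ≤ j₁ ≤ j₂ ≤ m. Define C_Q : [0,1] × [0,1] → ℝ on each cell [(i−1)/m, i/m] × [(j−1)/m, j/m] by C_Q(u,v) = (1−λ_i(u))(1−λ_j(v)) S(i−1, j−1) + (1−λ_i(u)) λ_j(v) S(i−1, j) + λ_i(u)(1−λ_j(v)) S(i, j−1) + λ_i(u) λ_j(v) S(i, j), where λ_i(u) = mu − (i−1) and λ_j(v) = mv − (j−1). Then C_Q is well defined, C_Q is a 2-copula, and C_Q(i/m, j/m) = S(i,j) for all i, j; that is, the bilinear (checkerboard) extension extends any subcopula on a uniform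 mesh to a 2-copula. -/
open Set

/-- Truncation of a real number to `[0,1]`. -/
noncomputable def clampUnit (t : ℝ) : ℝ := max 0 (min 1 t)

lemma clampUnit_mono {s t : ℝ} (h : s ≤ t) : clampUnit s ≤ clampUnit t := by
  unfold clampUnit
  gcongr

lemma clampUnit_of_nonpos {t : ℝ} (h : t ≤ 0) : clampUnit t = 0 := by
  unfold clampUnit
  exact max_eq_left ((min_le_right _ _).trans h)

lemma clampUnit_of_one_le {t : ℝ} (h : 1 ≤ t) : clampUnit t = 1 := by
  unfold clampUnit
  rw [min_eq_left h]
  norm_num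

lemma clampUnit_of_mem {t : ℝ} (h : 0 ≤ t) (h1 : t ≤ 1) : clampUnit t = t := by
  unfold clampUnit
  rw [min_eq_right h1, max_eq_right h]

/-- Piecewise linear interpolation of `f 0, …, f n`. -/
noncomputable def interp (n : ℕ) (f : ℕ → ℝ) (y : ℝ) : ℝ :=
  f 0 + ∑ k ∈ Finset.range n, clampUnit (y - k) * (f (k + 1) - f k)

lemma interp_succ (n : ℕ) (f : ℕ → ℝ) (y : ℝ) :
    interp (n + 1) f y = interp n f y + clampUnit (y - n) * (f (n + 1) - f n) := by
  unfold interp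
  rw [Finset.sum_range_succ]
  ring

lemma interp_zero (f : ℕ → ℝ) (y : ℝ) : interp 0 f y = f 0 := by
  simp [interp]

lemma interp_sub (n : ℕ) (f g : ℕ → ℝ) (y : ℝ) :
    interp n (fun k => f k - g k) y = interp n f y - interp n g y := by
  induction n with
  | zero => simp [interp_zero]
  | succ n ih => rw [interp_succ, interp_succ, interp_succ, ih]; ring

lemma interp_congr (n : ℕ) (f g : ℕ → ℝ) (y : ℝ) (h : ∀ k ≤ n, f k = g k) :
    interp n f y = interp n g y := by
  induction n with
  | zero => simp [interp_zero, h]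
  | succ n ih =>
    rw [interp_succ, interp_succ, ih (fun k hk => h k (by omega)), h n (by omega),
      h (n + 1) le_rfl]

lemma interp_const_zero (n : ℕ) (y : ℝ) : interp n (fun _ => 0) y = 0 := by
  simp [interp]

lemma interp_mono (n : ℕ) (f : ℕ → ℝ) {x y : ℝ} (hxy : x ≤ y)
    (h : ∀ k, k < n → f k ≤ f (k + 1)) : interp n f x ≤ interp n f y := by
  unfold interp
  gcongr with k hk
  · exact sub_nonneg.2 (h k (Finset.mem_range.1 hk))
  · exact clampUnit_mono (by linarith)

lemma interp_of_le (n : ℕ) (f : ℕ → ℝ) {y : ℝ} (h : (n : ℝ) ≤ y) : interp n f y = f n := by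
  induction n with
  | zero => simp [interp_zero]
  | succ n ih =>
    push_cast at h
    rw [interp_succ, ih (by linarith), clampUnit_of_one_le (by linarith)]
    ring

lemma interp_of_ge (i n : ℕ) (hin : i ≤ n) (f : ℕ → ℝ) {y : ℝ} (h : y ≤ i) :
    interp n f y = interp i f y := by
  induction n, hin using Nat.le_induction with
  | base => rfl
  | succ n hn ih =>
    have : (i : ℝ) ≤ n := by exact_mod_cast hn
    rw [interp_succ, ih, clampUnit_of_nonpos (by linarith)]
    ring

lemma interp_nat (i n : ℕ) (hin : i ≤ n) (f : ℕ → ℝ) : interp n f (i : ℝ) = f i := by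
  rw [interp_of_ge i n hin f le_rfl, interp_of_le i f le_rfl]

lemma interp_cell (i n : ℕ) (hi : 1 ≤ i) (hin : i ≤ n) (f : ℕ → ℝ) {y : ℝ}
    (h1 : (i : ℝ) - 1 ≤ y) (h2 : y ≤ i) :
    interp n f y = (1 - (y - ((i : ℝ) - 1))) * f (i - 1) + (y - ((i : ℝ) - 1)) * f i := by
  obtain ⟨k, rfl⟩ : ∃ k, i = k + 1 := ⟨i - 1, by omega⟩
  rw [interp_of_ge _ n hin f h2, interp_succ]
  push_cast at *
  rw [interp_of_le k f (by linarith), clampUnit_of_mem (by linarith) (by linarith)]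
  ring

lemma interp_linear (n : ℕ) (c : ℝ) {y : ℝ} (h0 : 0 ≤ y) :
    interp n (fun k => (k : ℝ) / c) y = min y n / c := by
  induction n with
  | zero => simp [interp_zero, h0]
  | succ n ih =>
    rw [interp_succ, ih]
    push_cast
    rcases le_total y n with h | h
    · rw [clampUnit_of_nonpos (by linarith), min_eq_left h, min_eq_left (by linarith)]
      ring
    · rcases le_total y (n + 1) with h' | h'
      · rw [clampUnit_of_mem (by linarith) (by linarith), min_eq_right h, min_eq_left h']
        ring
      · rw [clampUnit_of_one_le (by linarith), min_eq_right h, min_eq_right h']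
        ring

/-- The bilinear (checkerboard) extension of any subcopula on a uniform mesh is well
defined (a single function satisfies the bilinear formula on every closed cell),
is a 2-copula, and agrees with the subcopula at the grid points. Here `S i j` stands
for the subcopula value at `(i/m, j/m)`. -/
theorem checkerboard_extension_of_subcopula_isCopula
    (m : ℕ) (hm : 1 ≤ m) (S : ℕ → ℕ → ℝ)
    (hS0 : ∀ i ≤ m, S i 0 = 0 ∧ S 0 i = 0)
    (hS1 : ∀ i ≤ m, S i m = (i : ℝ) / m ∧ S m i = (i : ℝ) / m)
    (hSinc : ∀ i₁ i₂ j₁ j₂ : ℕ, i₁ ≤ i₂ → i₂ ≤ m → j₁ ≤ j₂ → j₂ ≤ m →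
      0 ≤ S i₂ j₂ - S i₂ j₁ - S i₁ j₂ + S i₁ j₁) :
    ∃ CQ : ℝ → ℝ → ℝ,
      (∀ i j : ℕ, 1 ≤ i → i ≤ m → 1 ≤ j → j ≤ m →
        ∀ u v : ℝ, u ∈ Icc (((i : ℝ) - 1) / m) ((i : ℝ) / m) →
          v ∈ Icc (((j : ℝ) - 1) / m) ((j : ℝ) / m) →
          CQ u v =
            (1 - (m * u - ((i : ℝ) - 1))) * (1 - (m * v - ((j : ℝ) - 1))) * S (i - 1) (j - 1)
            + (1 - (m * u - ((i : ℝ) - 1))) * (m * v - ((j : ℝ) - 1)) * S (i - 1) j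
            + (m * u - ((i : ℝ) - 1)) * (1 - (m * v - ((j : ℝ) - 1))) * S i (j - 1)
            + (m * u - ((i : ℝ) - 1)) * (m * v - ((j : ℝ) - 1)) * S i j) ∧
      IsCopula CQ ∧
      (∀ i j : ℕ, i ≤ m → j ≤ m → CQ ((i : ℝ) / m) ((j : ℝ) / m) = S i j) := by
  have hm0 : (0 : ℝ) < m := by exact_mod_cast hm
  have hscale : ∀ i : ℕ, (m : ℝ) * ((i : ℝ) / m) = i := fun i => by field_simp
  have hlin : ∀ u ∈ Icc (0 : ℝ) 1, interp m (fun k => (k : ℝ) / m) (m * u) = u := by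
    intro u hu
    rw [interp_linear m m (mul_nonneg hm0.le hu.1), min_eq_left (by nlinarith [hu.2])]
    field_simp
  have hz : ∀ f : ℕ → ℝ, interp m f 0 = f 0 := fun f => by
    simpa using interp_nat 0 m (Nat.zero_le m) f
  have ho : ∀ f : ℕ → ℝ, interp m f m = f m := fun f => interp_nat m m le_rfl f
  refine ⟨fun u v => interp m (fun i => interp m (S i) (m * v)) (m * u), ?_, ?_, ?_⟩
  · intro i j hi him hj hjm u v hu hv
    have hu1 := (div_le_iff₀' hm0).1 hu.1
    have hu2 := (le_div_iff₀' hm0).1 hu.2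
    have hv1 := (div_le_iff₀' hm0).1 hv.1
    have hv2 := (le_div_iff₀' hm0).1 hv.2
    simp only [interp_cell i m hi him _ hu1 hu2, interp_cell j m hj hjm _ hv1 hv2]
    ring
  · refine ⟨?_, ?_, ?_, ?_, ?_⟩
    · intro u hu
      simp only [mul_zero, hz]
      rw [interp_congr m _ (fun _ => 0) _ (fun k hk => (hS0 k hk).1), interp_const_zero]
    · intro v hv
      simp only [mul_zero, hz]
      rw [interp_congr m _ (fun _ => 0) _ (fun k hk => (hS0 k hk).2), interp_const_zero]
    · intro u hu
      simp only [mul_one, ho]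
      rw [interp_congr m _ _ _ (fun k hk => (hS1 k hk).1), hlin u hu]
    · intro v hv
      simp only [mul_one, ho]
      rw [interp_congr m _ _ _ (fun k hk => (hS1 k hk).2), hlin v hv]
    · intro u₁ u₂ v₁ v₂ _ _ _ _ hu hv
      have hu' : (m : ℝ) * u₁ ≤ m * u₂ := mul_le_mul_of_nonneg_left hu hm0.le
      have hv' : (m : ℝ) * v₁ ≤ m * v₂ := mul_le_mul_of_nonneg_left hv hm0.le
      have key := interp_mono m
        (fun i => interp m (S i) (m * v₂) - interp m (S i) (m * v₁)) hu' (by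
          intro i hi
          have h := interp_mono m (fun j => S (i + 1) j - S i j) hv' (by
            intro j hj
            have := hSinc i (i + 1) j (j + 1) (by omega) (by omega) (by omega) (by omega)
            linarith)
          rw [interp_sub, interp_sub] at h
          linarith)
      rw [interp_sub, interp_sub] at key
      linarith
  · intro i j hi hj
    simp only [hscale]
    rw [interp_nat i m hi, interp_nat j m hj]
end
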